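/- arXiv:1209.2038 — 10 statements merged into one kernel-verified Lean document; each statement's English description precedes it below -/
import Mathlib

section
/- If a stable configuration η can be reached from the maximal stable configuration η^max by some finite sequence of grain additions and legal partial topplings, then there exists an orientation O of G such that η is compatible with O. (In other words, Sto(G) ⊆ ∪_O comp(O), where the union is over all orientations of G.) -/
open Finset Polynomial

open scoped Classical

namespace SSM

variable {V : Type*} [Fintype V] [DecidableEq V]

/-- The degree of a vertex: sum of edge multiplicities to all other vertices.
    Vertices are `Option V`, with `none` playing the role of the sink `s`. -/
def deg (m : Option V → Option V → ℕ) (u : Option V) : ℕ := ∑ w : Option V, m u w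

/-- `m` is a symmetric, loop-free edge-multiplicity function whose underlying
    graph is connected. -/
def IsGraph (m : Option V → Option V → ℕ) : Prop :=
  (∀ u w, m u w = m w u) ∧ (∀ u, m u u = 0) ∧
    (SimpleGraph.fromRel fun u w : Option V => m u w ≠ 0).Connected

/-- An orientation of the multigraph: `o u w` copies of the edge `{u,w}` are
    oriented from `u` to `w`, and `o u w + o w u = m u w`. -/
def IsOrientation (m o : Option V → Option V → ℕ) : Prop :=
  ∀ u w, o u w + o w u = m u w

/-- In-degree of a vertex in an orientation. -/
def inDeg (o : Option V → Option V → ℕ) (w : Option V) : ℕ := ∑ u : Option V, o u w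

/-- A configuration is stable if every non-sink vertex carries at most its degree. -/
def Stable (m : Option V → Option V → ℕ) (η : V → ℕ) : Prop :=
  ∀ v : V, η v ≤ deg m (some v)

/-- `η` is compatible with the orientation `o`: for each non-sink vertex `v`,
    `in_O(v) ≥ 1 + l_η(v)`, stated additively as `deg v + 1 ≤ in_O(v) + η v`. -/
def Compatible (m o : Option V → Option V → ℕ) (η : V → ℕ) : Prop :=
  ∀ v : V, deg m (some v) + 1 ≤ inDeg o (some v) + η v

/-- The set `Sto(G)`: stable configurations compatible with at least one orientation. -/
def Sto (m : Option V → Option V → ℕ) (η : V → ℕ) : Prop :=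
  Stable m η ∧ ∃ o, IsOrientation m o ∧ Compatible m o η

/-- Total lacking number `ℓ(η) = ∑_v (deg v − η v)`. -/
def totalLacking (m : Option V → Option V → ℕ) (η : V → ℕ) : ℕ :=
  ∑ v : V, (deg m (some v) - η v)

/-- The lacking polynomial `L_G(x) = ∑_{η ∈ Sto(G)} x^{ℓ(η)}`. -/
noncomputable def lackingPoly (m : Option V → Option V → ℕ) : Polynomial ℤ :=
  ∑ η ∈ (Fintype.piFinset fun v : V => Finset.range (deg m (some v) + 1)).filter
      (fun η => Sto m η),
    (X : Polynomial ℤ) ^ totalLacking m η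

/-- The maximal stable configuration `η^max`. -/
def etaMax (m : Option V → Option V → ℕ) : V → ℕ := fun v => deg m (some v)

/-- A grain addition at some non-sink vertex. -/
def AddGrain (η η' : V → ℕ) : Prop := ∃ v : V, η' = Function.update η v (η v + 1)

/-- A legal partial toppling: some vertex `x` with `η x > deg x` sends `α u ≤ m x u`
    grains to each vertex `u` (grains sent to the sink are lost). -/
def PartialTopple (m : Option V → Option V → ℕ) (η η' : V → ℕ) : Prop :=
  ∃ x : V, deg m (some x) < η x ∧ ∃ α : Option V → ℕ, (∀ u, α u ≤ m (some x) u) ∧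
    ∀ v : V, η' v = if v = x then η x - ∑ u : Option V, α u else η v + α (some v)

/-- Reachability by a finite sequence of grain additions and legal partial topplings. -/
def Reaches (m : Option V → Option V → ℕ) : (V → ℕ) → (V → ℕ) → Prop :=
  Relation.ReflTransGen fun η η' => AddGrain η η' ∨ PartialTopple m η η'

/-- A legal full toppling (Abelian sandpile model): an unstable vertex `x` sends
    `m x u` grains to each vertex `u`. -/
def FullTopple (m : Option V → Option V → ℕ) (η η' : V → ℕ) : Prop :=
  ∃ x : V, deg m (some x) < η x ∧
    ∀ v : V, η' v = if v = x then η x - deg m (some x) else η v + m (some x) (some v)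

/-- `η` passes the burning algorithm: the non-sink vertices can be enumerated
    `v_1, …, v_n` with `η(v_i) > ∑_{j > i} m(v_i, v_j)`. -/
def Burns (m : Option V → Option V → ℕ) (η : V → ℕ) : Prop :=
  ∃ e : Fin (Fintype.card V) ≃ V, ∀ i : Fin (Fintype.card V),
    ∑ j ∈ Finset.univ.filter (fun j : Fin (Fintype.card V) => i < j),
      m (some (e i)) (some (e j)) < η (e i)

/-- An orientation is acyclic if the digraph with an arc `u → w` whenever
    `o u w ≥ 1` has no directed cycle. -/
def IsAcyclic (o : Option V → Option V → ℕ) : Prop :=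
  ∀ u : Option V, ¬ Relation.TransGen (fun x y : Option V => 1 ≤ o x y) u u

/-- Deletion of one copy of the edge `{a,b}`. -/
def deleteM (m : Option V → Option V → ℕ) (a b : V) (u w : Option V) : ℕ :=
  if (u = some a ∧ w = some b) ∨ (u = some b ∧ w = some a) then m u w - 1 else m u w

/-- Contraction of the edge `{a,b}`: merge `b` into `a` (the merged vertex `a.b` is
    represented by `a` in the subtype `{v // v ≠ b}`), delete all `k = m a b` edges
    between `a` and `b`, and add `k − 1` new edges between `a.b` and the sink. -/
def contractM (m : Option V → Option V → ℕ) (a b : V) :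
    Option {v : V // v ≠ b} → Option {v : V // v ≠ b} → ℕ
  | none, none => 0
  | none, some w =>
      if w.1 = a then m none (some a) + m none (some b) + (m (some a) (some b) - 1)
      else m none (some w.1)
  | some u, none =>
      if u.1 = a then m none (some a) + m none (some b) + (m (some a) (some b) - 1)
      else m (some u.1) none
  | some u, some w =>
      if u.1 = a then
        (if w.1 = a then 0 else m (some a) (some w.1) + m (some b) (some w.1))
      else if w.1 = a then m (some u.1) (some a) + m (some u.1) (some b)
      else m (some u.1) (some w.1)

/-- `Sto_A(G)`: configurations in `Sto(G)` having a compatible orientation with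
    `o(a,b) ≥ 1` and `l_η(b) > 0`. -/
def StoA (m : Option V → Option V → ℕ) (a b : V) (η : V → ℕ) : Prop :=
  Stable m η ∧ ∃ o, IsOrientation m o ∧ Compatible m o η ∧
    1 ≤ o (some a) (some b) ∧ η b < deg m (some b)

/-- `Sto_B(G) = Sto(G) ∖ Sto_A(G)`. -/
def StoB (m : Option V → Option V → ℕ) (a b : V) (η : V → ℕ) : Prop :=
  Sto m η ∧ ¬ StoA m a b η

/-- On `Sto_A(G)`, `f(η) = η − 1_a`, a configuration on `G∖e`. -/
def fA (a : V) (η : V → ℕ) : V → ℕ := Function.update η a (η a - 1)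

/-- On `Sto_B(G)`, `f(η)` is the configuration on `G.e` agreeing with `η` away from
    `a, b` and with `f(η)(a.b) = deg_{G.e}(a.b) − l_η(a) − l_η(b)`. -/
def fB (m : Option V → Option V → ℕ) (a b : V) (hab : a ≠ b) (η : V → ℕ)
    (v : {v : V // v ≠ b}) : ℕ :=
  if v.1 = a then
    deg (contractM m a b) (some ⟨a, hab⟩) -
      ((deg m (some a) - η a) + (deg m (some b) - η b))
  else η v.1

/-- `T = (V' ∪ {r}, E')` is a tree branch of `G`: a sub-multigraph (with edge
    multiplicities `mT` on non-sink vertices) which is a tree on `V' ∪ {r}`,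
    such that every `v ∈ V'` has all of its `G`-edges inside `T`, and which is
    attached to the rest of `G` only at `r ∈ V ∖ V'`. -/
structure IsTreeBranch (m : Option V → Option V → ℕ) (V' : Finset V) (r : V)
    (mT : V → V → ℕ) : Prop where
  not_mem : r ∉ V'
  symm : ∀ u v, mT u v = mT v u
  loopless : ∀ v, mT v v = 0
  le : ∀ u v, mT u v ≤ m (some u) (some v)
  support : ∀ u v, mT u v ≠ 0 → (u ∈ V' ∨ u = r) ∧ (v ∈ V' ∨ v = r)
  deg_eq : ∀ v ∈ V', ∑ u : V, mT v u = deg m (some v)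
  conn : ∀ v ∈ V', (SimpleGraph.fromRel fun x y : V => mT x y ≠ 0).Reachable r v
  card_edges : ∑ u : V, ∑ v : V, mT u v = 2 * V'.card

lemma exists_orient_max (m : Option V → Option V → ℕ) (hG : IsGraph m) :
    ∃ o : Option V → Option V → ℕ, IsOrientation m o ∧ Compatible m o (etaMax m) := by
  obtain ⟨hs, hl, hc⟩ := hG
  set G := SimpleGraph.fromRel fun u w : Option V => m u w ≠ 0 with hGdef
  let d : Option V → ℕ := fun u => G.dist u none
  let e : Option V → ℕ := fun u => (Fintype.equivFin (Option V) u : ℕ)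
  have he : ∀ u w, e u = e w → u = w := fun u w h =>
    (Fintype.equivFin (Option V)).injective (Fin.ext h)
  refine ⟨fun u w => if d u < d w ∨ (d u = d w ∧ e u < e w) then m u w else 0, ?_, ?_⟩
  · intro u w
    have h1 := hs u w
    by_cases huw : u = w
    · subst huw
      simp [hl]
    · have h2 : e u ≠ e w := fun h => huw (he u w h)
      dsimp only
      split_ifs <;> omega
  · intro v
    have : ∃ u, d u < d (some v) ∧ m u (some v) ≠ 0 := by
      obtain ⟨p, hp⟩ := hc.exists_walk_length_eq_dist (some v) none
      cases p with
      | cons h p =>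
        rename_i u
        refine ⟨u, ?_, ?_⟩
        · have := SimpleGraph.dist_le p
          simp only [SimpleGraph.Walk.length_cons] at hp
          change G.dist u none < G.dist (some v) none
          omega
        · rw [hGdef, SimpleGraph.fromRel_adj] at h
          have := hs u (some v)
          rcases h.2 with h | h <;> omega
    obtain ⟨u, hu, hm⟩ := this
    have h := Finset.single_le_sum (f := fun u => if d u < d (some v) ∨
      (d u = d (some v) ∧ e u < e (some v)) then m u (some v) else 0)
      (fun _ _ => Nat.zero_le _) (Finset.mem_univ u)
    simp only [hu, true_or, if_true] at h
    have h' : 1 ≤ inDeg (fun u w => if d u < d w ∨ (d u = d w ∧ e u < e w)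
        then m u w else 0) (some v) := by
      refine le_trans ?_ h
      omega
    unfold etaMax
    omega

lemma topple_step (m : Option V → Option V → ℕ) (hG : IsGraph m) (η η' : V → ℕ)
    (ht : PartialTopple m η η')
    (h : ∃ o : Option V → Option V → ℕ, IsOrientation m o ∧ Compatible m o η) :
    ∃ o : Option V → Option V → ℕ, IsOrientation m o ∧ Compatible m o η' := by
  obtain ⟨hs, hl, -⟩ := hG
  obtain ⟨o, ho, hc⟩ := h
  obtain ⟨x, hx, α, hα, hη⟩ := ht
  refine ⟨fun u w => if w = some x then max (o u w) (α u)
    else if u = some x then m u w - max (o w u) (α w) else o u w, ?_, ?_⟩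
  · intro u w
    have h1 := ho u w
    have h2 := hs u w
    have h3 := hα u
    have h4 := hα w
    dsimp only
    by_cases hu : u = some x <;> by_cases hw : w = some x
    · subst hu; subst hw
      have := hl (some x)
      simp only [if_true]
      omega
    · subst hu
      simp only [hw, if_true, if_false]
      omega
    · subst hw
      simp only [hu, if_true, if_false]
      omega
    · simp only [hu, hw, if_false]
      omega
  · intro v
    have hv := hc v
    unfold inDeg at hv ⊢
    rw [hη v]
    by_cases hvx : v = x
    · subst hvx
      simp only [if_true]
      have : ∑ u, α u ≤ ∑ u, max (o u (some v)) (α u) :=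
        Finset.sum_le_sum fun u _ => le_max_right _ _
      omega
    · have hne : some v ≠ some x := fun h => hvx (Option.some.inj h)
      simp only [hvx, hne, if_false]
      have : ∑ u, o u (some v) ≤ ∑ u, ((if u = some x then
          m u (some v) - max (o (some v) u) (α (some v)) else o u (some v))
          + if u = some x then α (some v) else 0) := by
        apply Finset.sum_le_sum
        intro u _
        by_cases hu : u = some x
        · subst hu
          have h1 := ho (some x) (some v)
          have h2 := hα (some v)
          simp only [if_true]
          omega
        · simp [hu]
      rw [Finset.sum_add_distrib] at this
      simp only [Finset.sum_ite_eq', Finset.mem_univ, if_true] at this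
      omega

/-- If a stable configuration `η` can be reached from `η^max` by a
finite sequence of grain additions and legal partial topplings, then `η` is
compatible with some orientation of `G`. -/
theorem sto_subset_compatible (m : Option V → Option V → ℕ) (hG : IsGraph m)
    (η : V → ℕ) (hstab : Stable m η) (hreach : Reaches m (etaMax m) η) :
    ∃ o : Option V → Option V → ℕ, IsOrientation m o ∧ Compatible m o η := by
  clear hstab
  unfold Reaches at hreach
  induction hreach with
  | refl => exact exists_orient_max m hG
  | tail _ hstep ih =>
    rcases hstep with ⟨v, rfl⟩ | ht
    · obtain ⟨o, ho, hc⟩ := ih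
      refine ⟨o, ho, fun w => ?_⟩
      have := hc w
      by_cases hw : w = v
      · subst hw
        simp only [Function.update_self]
        omega
      · simpa [Function.update_of_ne hw] using this
    · exact topple_step m hG _ _ ht ih

end SSM
end

section
/- If a stable configuration η is compatible with some orientation O of G, then η can be reached from the maximal stable configuration η^max by some finite sequence of grain additions and legal partial topplings. (In other words, ∪_O comp(O) ⊆ Sto(G), where the union is over all orientations of G.) -/
open Finset Polynomial

open scoped Classical

namespace SSM

variable {V : Type*} [Fintype V] [DecidableEq V]

def cfg (o : Option V → Option V → ℕ) (e : V → ℕ) : V → ℕ :=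
  fun v => e v + 1 + ∑ w : Option V, o (some v) w

def bump (e : V → ℕ) (v : V) : V → ℕ := fun x => if x = v then e x + 1 else e x

lemma bump_induct (P : (V → ℕ) → Prop) (e₀ : V → ℕ) (h0 : P e₀)
    (hs : ∀ e v, P e → P (bump e v)) : ∀ (n : ℕ) (e : V → ℕ), (∀ v, e₀ v ≤ e v) →
      ∑ v, (e v - e₀ v) = n → P e := by
  intro n
  induction n with
  | zero =>
    intro e hle hsum
    have : e = e₀ := by
      funext v
      have := (Finset.sum_eq_zero_iff.mp hsum) v (Finset.mem_univ v)
      have := hle v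
      omega
    rw [this]; exact h0
  | succ n ih =>
    intro e hle hsum
    have : ∃ v, e v - e₀ v ≠ 0 := by
      by_contra! h
      rw [Finset.sum_eq_zero (fun v _ => h v)] at hsum
      omega
    obtain ⟨v, hv⟩ := this
    let e' : V → ℕ := fun x => if x = v then e x - 1 else e x
    have he : e = bump e' v := by
      funext x
      simp only [bump, e']
      split_ifs with hx
      · subst hx; omega
      · rfl
    rw [he]
    apply hs
    apply ih
    · intro x
      simp only [e']
      split_ifs with hx
      · subst hx; omega
      · exact hle x
    · have h1 : ∀ x, e x - e₀ x = (e' x - e₀ x) + if x = v then 1 else 0 := by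
        intro x
        simp only [e']
        split_ifs with hx
        · subst hx; omega
        · rfl
      rw [Finset.sum_congr rfl (fun x _ => h1 x), Finset.sum_add_distrib,
        Finset.sum_ite_eq' Finset.univ v] at hsum
      simp at hsum
      exact hsum

lemma fire (m : Option V → Option V → ℕ) (hG : IsGraph m) (o : Option V → Option V → ℕ)
    (ho : IsOrientation m o) (e : V → ℕ) (v : V) :
    ∃ o', IsOrientation m o' ∧ (∀ w, o' (some v) w = m (some v) w) ∧
      Reaches m (cfg o' e) (cfg o e) := by
  obtain ⟨hsym, hloop, -⟩ := hG
  let o' : Option V → Option V → ℕ := fun a b =>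
    if a = some v then m a b else if b = some v then 0 else o a b
  have hv : ∀ w, o' (some v) w = m (some v) w := fun w => by simp [o']
  refine ⟨o', ?_, hv, ?_⟩
  · intro a b
    simp only [o']
    have h1 := hsym a b
    have h2 := ho a b
    by_cases ha : a = some v <;> by_cases hb : b = some v
    · subst ha; subst hb; simp [hloop]
    · simp [ha, hb]
    · simp [ha, hb]; rw [← hb]; exact h1.symm
    · simp [ha, hb]; exact h2
  · apply Relation.ReflTransGen.single
    right
    refine ⟨v, ?_, fun u => o u (some v), ?_, ?_⟩
    · simp only [cfg, hv, deg]; omega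
    · intro u
      have h1 := hsym u (some v)
      have h2 := ho u (some v)
      simp only; omega
    · intro x
      split_ifs with hx
      · subst hx
        simp only [cfg, hv]
        have : ∑ w, m (some x) w = ∑ w, o (some x) w + ∑ w, o w (some x) := by
          rw [← Finset.sum_add_distrib]
          exact Finset.sum_congr rfl (fun w _ => (ho _ _).symm)
        omega
      · simp only [cfg]
        have h1 : ∀ w, o (some x) w = o' (some x) w + if w = some v then o (some x) (some v) else 0 := by
          intro w
          by_cases hw : w = some v <;> simp [o', hx, hw]
        have : ∑ w, o (some x) w = ∑ w, o' (some x) w + o (some x) (some v) := by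
          rw [Finset.sum_congr rfl (fun w _ => h1 w), Finset.sum_add_distrib,
            Finset.sum_ite_eq' Finset.univ (some v)]
          simp
        omega

def Claim (m : Option V → Option V → ℕ) (v : V) : Prop :=
  ∀ o e, IsOrientation m o → ∃ o', IsOrientation m o' ∧ Reaches m (cfg o' (bump e v)) (cfg o e)

lemma claim_sink (m : Option V → Option V → ℕ) (hG : IsGraph m) (v : V)
    (hv : m (some v) none ≠ 0) : Claim m v := by
  intro o e ho
  obtain ⟨o₁, h1, h2, h3⟩ := fire m hG o ho e v
  let o' : Option V → Option V → ℕ := fun a b =>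
    if a = some v ∧ b = none then o₁ a b - 1 else
      if a = none ∧ b = some v then o₁ a b + 1 else o₁ a b
  have hpos : o₁ (some v) none ≠ 0 := by rw [h2]; exact hv
  refine ⟨o', ?_, ?_⟩
  · intro a b
    have := h1 a b
    simp only [o']
    by_cases c1 : a = some v ∧ b = none
    · obtain ⟨rfl, rfl⟩ := c1
      simp; omega
    · by_cases c2 : a = none ∧ b = some v
      · obtain ⟨rfl, rfl⟩ := c2
        simp; omega
      · have c1' : ¬ (b = none ∧ a = some v) := fun h => c1 h.symm
        have c2' : ¬ (b = some v ∧ a = none) := fun h => c2 h.symm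
        simp only [c1, c2, c1', c2', if_false]; exact this
  · convert h3 using 1
    funext x
    simp only [cfg, bump]
    by_cases hx : x = v
    · subst hx
      have h4 : ∀ w, o₁ (some x) w = o' (some x) w + if w = none then 1 else 0 := by
        intro w
        by_cases hw : w = none
        · subst hw; simp [o']; omega
        · simp [o', hw]
      have : ∑ w, o₁ (some x) w = ∑ w, o' (some x) w + 1 := by
        rw [Finset.sum_congr rfl (fun w _ => h4 w), Finset.sum_add_distrib,
          Finset.sum_ite_eq' Finset.univ none]
        simp
      simp only [if_true]
      omega
    · have h4 : ∀ w, o' (some x) w = o₁ (some x) w := by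
        intro w
        simp [o', hx]
      simp [hx, h4]

lemma claim_step (m : Option V → Option V → ℕ) (hG : IsGraph m) (u v : V)
    (hv : m (some v) (some u) ≠ 0) (hu : Claim m u) : Claim m v := by
  intro o e ho
  have huv : u ≠ v := by
    rintro rfl
    exact hv (hG.2.1 _)
  obtain ⟨o₁, h1, h2⟩ := hu o e ho
  obtain ⟨o₂, h3, h4, h5⟩ := fire m hG o₁ h1 (bump e u) v
  refine ⟨o₂, h3, Relation.ReflTransGen.trans ?_ (Relation.ReflTransGen.trans h5 h2)⟩
  apply Relation.ReflTransGen.single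
  right
  refine ⟨v, ?_, fun w => if w = some u then 1 else 0, ?_, ?_⟩
  · simp only [cfg, h4, deg, bump]; omega
  · intro w
    simp only
    split_ifs with hw
    · subst hw; omega
    · omega
  · intro x
    rw [Finset.sum_ite_eq' Finset.univ (some u)]
    simp only [cfg, bump, Finset.mem_univ, if_true]
    by_cases hx : x = v
    · subst hx
      simp [huv.symm]
    · by_cases hxu : x = u
      · subst hxu
        (simp [hx]; try omega)
      · simp [hx, hxu]

lemma claim_all (m : Option V → Option V → ℕ) (hG : IsGraph m) (v : V) : Claim m v := by
  have hr := hG.2.2.preconnected none (some v)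
  rw [SimpleGraph.reachable_iff_reflTransGen] at hr
  have key : ∀ a : Option V, Relation.ReflTransGen
      (SimpleGraph.fromRel fun u w : Option V => m u w ≠ 0).Adj none a →
      ∀ v, a = some v → Claim m v := by
    intro a ha
    induction ha with
    | refl => intro v h; cases h
    | @tail b c _ hbc ih =>
      rintro v rfl
      have hne : m (some v) b ≠ 0 := by
        rw [SimpleGraph.fromRel_adj] at hbc
        rcases hbc.2 with h | h
        · rw [hG.1]; exact h
        · exact h
      cases b with
      | none => exact claim_sink m hG v hne
      | some u => exact claim_step m hG u v hne (ih u rfl)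
  exact key _ hr v rfl

/-- If a stable configuration `η` is compatible with some orientation
of `G`, then `η` can be reached from `η^max` by a finite sequence of grain
additions and legal partial topplings. -/
theorem compatible_subset_sto (m : Option V → Option V → ℕ) (hG : IsGraph m)
    (η : V → ℕ) (hstab : Stable m η)
    (o : Option V → Option V → ℕ) (ho : IsOrientation m o) (hc : Compatible m o η) :
    Reaches m (etaMax m) η := by
  let e : V → ℕ := fun v => η v - 1 - ∑ w : Option V, o (some v) w
  have hη : cfg o e = η := by
    funext v
    have h := hc v
    have : deg m (some v) = ∑ w, o (some v) w + inDeg o (some v) := by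
      simp only [deg, inDeg]
      rw [← Finset.sum_add_distrib]
      exact Finset.sum_congr rfl (fun w _ => (ho _ _).symm)
    simp only [cfg, e]
    omega
  have hup : ∃ o', IsOrientation m o' ∧
      Reaches m (cfg o' (fun v => e v + deg m (some v))) (cfg o e) := by
    refine bump_induct (fun e' => ∃ o', IsOrientation m o' ∧ Reaches m (cfg o' e') (cfg o e)) e
      ⟨o, ho, Relation.ReflTransGen.refl⟩ ?_ _ _ (fun v => Nat.le_add_right _ _) rfl
    rintro e' v ⟨o', h1, h2⟩
    obtain ⟨o'', h3, h4⟩ := claim_all m hG v o' e' h1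
    exact ⟨o'', h3, Relation.ReflTransGen.trans h4 h2⟩
  obtain ⟨o', -, h2⟩ := hup
  rw [hη] at h2
  refine Relation.ReflTransGen.trans ?_ h2
  refine bump_induct (fun ξ => Reaches m (etaMax m) ξ) (etaMax m)
    Relation.ReflTransGen.refl ?_ _ _ ?_ rfl
  · intro ξ v h
    refine Relation.ReflTransGen.tail h (Or.inl ⟨v, ?_⟩)
    funext x
    by_cases hx : x = v
    · subst hx; simp [bump]
    · simp [bump, hx]
  · intro v
    simp only [cfg, etaMax]
    omega
end SSM
end

section
/- A stable configuration η on G can be reached from the maximal stable configuration η^max by a finite sequence of grain additions and legal partial topplings if and only if there exists an orientation O of G such that η is compatible with O. (Characterisation of the stochastically recurrent configurations: Sto(G) = ∪_O comp(O), where the union is over all orientations of G.) -/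
open Finset Polynomial

open scoped Classical

namespace SSM

variable {V : Type*} [Fintype V] [DecidableEq V]

theorem grow_induction (m : Option V → Option V → ℕ) (hG : IsGraph m)
    (P : Finset V → Prop) (h0 : P ∅)
    (hs : ∀ (S : Finset V) (y : V) (x : Option V), P S → y ∉ S →
      (∀ z, x = some z → z ∈ S) → m x (some y) ≠ 0 → P (insert y S)) :
    P Finset.univ := by
  have key : ∀ n, ∀ S : Finset V, P S → Sᶜ.card = n → P Finset.univ := by
    intro n
    induction n with
    | zero =>
      intro S hS hn
      have : S = Finset.univ := by
        rw [Finset.card_eq_zero] at hn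
        simpa using hn
      exact this ▸ hS
    | succ n ih =>
      intro S hS hn
      have hne : Sᶜ.Nonempty := by
        rw [← Finset.card_pos]; omega
      obtain ⟨w, hw⟩ := hne
      rw [Finset.mem_compl] at hw
      obtain ⟨p⟩ := hG.2.2.preconnected none (some w)
      obtain ⟨d, hd, h1, h2⟩ := p.exists_boundary_dart
        {x : Option V | ∀ z, x = some z → z ∈ S} (by simp) (by simpa using hw)
      obtain ⟨⟨x, y'⟩, hadj⟩ := d
      simp only [Set.mem_ofPred_eq, not_forall] at h1 h2
      obtain ⟨y, rfl, hy⟩ := h2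
      have hm : m x (some y) ≠ 0 := by
        have := hadj
        simp only [SimpleGraph.fromRel_adj] at this
        rcases this.2 with h | h
        · exact h
        · rw [hG.1]; exact h
      refine ih (insert y S) (hs S y x hS hy h1 hm) ?_
      rw [Finset.card_compl, Finset.card_insert_of_notMem hy]
      rw [Finset.card_compl] at hn
      omega
  exact key _ ∅ h0 rfl

theorem reaches_of_le (m : Option V → Option V → ℕ) (ξ η : V → ℕ) (h : ∀ v, ξ v ≤ η v) :
    Reaches m ξ η := by
  have key : ∀ n, ∀ ξ : V → ℕ, (∀ v, ξ v ≤ η v) → ∑ v, (η v - ξ v) = n → Reaches m ξ η := by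
    intro n
    induction n with
    | zero =>
      intro ξ h hn
      have : ξ = η := by
        funext v
        have := (Finset.sum_eq_zero_iff.mp hn) v (Finset.mem_univ v)
        have := h v
        omega
      subst this
      exact Relation.ReflTransGen.refl
    | succ n ih =>
      intro ξ h hn
      obtain ⟨v, -, hv⟩ : ∃ v ∈ Finset.univ, η v - ξ v ≠ 0 := by
        apply Finset.exists_ne_zero_of_sum_ne_zero
        omega
      refine Relation.ReflTransGen.head (b := Function.update ξ v (ξ v + 1)) (Or.inl ⟨v, rfl⟩) ?_
      apply ih
      · intro w
        by_cases hw : w = v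
        · subst hw; simp; omega
        · simp [hw, h w]
      · rw [← Finset.add_sum_erase _ _ (Finset.mem_univ v)] at hn ⊢
        have : ∑ x ∈ Finset.univ.erase v, (η x - Function.update ξ v (ξ v + 1) x)
            = ∑ x ∈ Finset.univ.erase v, (η x - ξ x) := by
          apply Finset.sum_congr rfl
          intro x hx
          rw [Function.update_of_ne (Finset.ne_of_mem_erase hx)]
        rw [this, Function.update_self]
        omega
  exact key _ ξ h rfl

theorem push_many (m : Option V → Option V → ℕ) (y : V) (u : Option V)
    (hu : u ≠ some y) (hm : m (some y) u ≠ 0) :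
    ∀ k (ξ η : V → ℕ), deg m (some y) + k ≤ ξ y →
      (∀ v, η v = if v = y then ξ y - k else ξ v + if some v = u then k else 0) →
      Reaches m ξ η := by
  intro k
  induction k with
  | zero =>
    intro ξ η _ h
    have : ξ = η := by
      funext v
      rw [h v]
      split_ifs with h1 <;> simp [h1]
    subst this
    exact Relation.ReflTransGen.refl
  | succ k ih =>
    intro ξ η hk h
    refine Relation.ReflTransGen.head
      (b := fun v => if v = y then ξ y - 1 else ξ v + if some v = u then 1 else 0)
      (Or.inr ⟨y, by omega, fun w => if w = u then 1 else 0, ?_, ?_⟩) ?_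
    · intro w
      dsimp only
      split_ifs with h1
      · subst h1; omega
      · omega
    · intro v
      simp
    · apply ih
      · simp; omega
      · intro v
        rw [h v]
        by_cases hv : v = y
        · simp [hv]; omega
        · simp only [hv, if_false]
          split_ifs <;> omega

theorem exists_orientation (m : Option V → Option V → ℕ) (hG : IsGraph m) :
    ∃ o, IsOrientation m o := by
  let e := Fintype.equivFin (Option V)
  refine ⟨fun u w => if e u < e w then m u w else 0, ?_⟩
  intro u w
  dsimp only
  rcases lt_trichotomy (e u) (e w) with h | h | h
  · simp [h, h.not_gt]
  · have := e.injective h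
    subst this
    simp [hG.2.1]
  · simp [h, h.not_gt, hG.1 u w]

theorem exists_good (m : Option V → Option V → ℕ) (hG : IsGraph m) :
    ∃ o, IsOrientation m o ∧ Compatible m o (etaMax m) := by
  have key : ∃ o, IsOrientation m o ∧ ∀ v ∈ (Finset.univ : Finset V), ∃ u : Option V,
      (∀ z, u = some z → z ∈ (Finset.univ : Finset V)) ∧ 1 ≤ o u (some v) := by
    refine grow_induction m hG (fun S => ∃ o, IsOrientation m o ∧ ∀ v ∈ S, ∃ u : Option V,
      (∀ z, u = some z → z ∈ S) ∧ 1 ≤ o u (some v)) ?_ ?_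
    · obtain ⟨o, ho⟩ := exists_orientation m hG
      exact ⟨o, ho, by simp⟩
    · rintro S y x ⟨o, ho, hS⟩ hy hx hm
      have hxy : x ≠ some y := fun h => hy (hx y h)
      refine ⟨fun u w => if w = some y then m u w else if u = some y then 0 else o u w, ?_, ?_⟩
      · intro u w
        have h1 := ho u w
        have h2 := hG.1 u w
        have h3 := hG.2.1 u
        dsimp only
        by_cases hu : u = some y
        · by_cases hw : w = some y
          · subst hu; subst hw; simp [h3]
          · simp [hu, hw]; rw [← hu, h2]
        · by_cases hw : w = some y <;> simp [hu, hw, h1]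
      · intro v hv
        rcases Finset.mem_insert.mp hv with rfl | hv
        · refine ⟨x, fun z hz => Finset.mem_insert_of_mem (hx z hz), ?_⟩
          simp; omega
        · obtain ⟨u, hu, h1⟩ := hS v hv
          refine ⟨u, fun z hz => Finset.mem_insert_of_mem (hu z hz), ?_⟩
          have a1 : some v ≠ some y := by
            rintro h; cases h; exact hy hv
          have a2 : u ≠ some y := fun h => hy (hu y h)
          simp only [a1, a2, if_false]
          exact h1
  obtain ⟨o, ho, h⟩ := key
  refine ⟨o, ho, fun v => ?_⟩
  obtain ⟨u, -, hu⟩ := h v (Finset.mem_univ v)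
  have : o u (some v) ≤ inDeg o (some v) :=
    Finset.single_le_sum (f := fun u => o u (some v)) (fun _ _ => Nat.zero_le _)
      (Finset.mem_univ u)
  simp only [etaMax]
  omega

theorem compat_topple (m : Option V → Option V → ℕ) (hG : IsGraph m) (η η' : V → ℕ)
    (o : Option V → Option V → ℕ) (ho : IsOrientation m o) (hc : Compatible m o η)
    (ht : PartialTopple m η η') : ∃ o, IsOrientation m o ∧ Compatible m o η' := by
  obtain ⟨x, hx, α, hα, h⟩ := ht
  have hαx : α (some x) = 0 := by
    have := hα (some x); rw [hG.2.1] at this; omega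
  have hb : ∀ u, max (α u) (o u (some x)) ≤ m (some x) u := by
    intro u
    have := ho u (some x)
    have := hG.1 u (some x)
    exact max_le (hα u) (by omega)
  refine ⟨fun u w => if w = some x then max (α u) (o u (some x)) else
    if u = some x then m (some x) w - max (α w) (o w (some x)) else o u w, ?_, ?_⟩
  · intro u w
    have h1 := ho u w
    have h2 := hG.1 u w
    have h3 := hb u
    have h4 := hb w
    dsimp only
    by_cases hu : u = some x
    · by_cases hw : w = some x
      · subst hu; subst hw
        have := hG.2.1 (some x)
        simp [hαx]; omega
      · subst hu; simp [hw]; omega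
    · by_cases hw : w = some x
      · subst hw; simp [hu]; omega
      · simp [hu, hw, h1]
  · intro v
    rw [h v]
    by_cases hv : v = x
    · subst hv
      simp only [if_true, inDeg]
      have h1 : ∑ u, α u ≤ ∑ u, max (α u) (o u (some v)) :=
        Finset.sum_le_sum fun u _ => le_max_left _ _
      have h2 : ∑ u, α u ≤ deg m (some v) := Finset.sum_le_sum fun u _ => hα u
      omega
    · have hc' := hc v
      simp only [inDeg, hv, if_false, Option.some.injEq] at hc' ⊢
      rw [← Finset.add_sum_erase _ _ (Finset.mem_univ (some x))] at hc' ⊢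
      have : ∑ u ∈ Finset.univ.erase (some x), (if u = some x then
          m (some x) (some v) - max (α (some v)) (o (some v) (some x)) else o u (some v))
          = ∑ u ∈ Finset.univ.erase (some x), o u (some v) := by
        apply Finset.sum_congr rfl
        intro u hu
        rw [if_neg (Finset.ne_of_mem_erase hu)]
      rw [this]
      simp only [if_true]
      have h1 := ho (some x) (some v)
      have h2 := hα (some v)
      omega

theorem compat_of_reaches (m : Option V → Option V → ℕ) (hG : IsGraph m) {η : V → ℕ}
    (h : Reaches m (etaMax m) η) : ∃ o, IsOrientation m o ∧ Compatible m o η := by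
  induction h with
  | refl => exact exists_good m hG
  | tail _ hs ih =>
    obtain ⟨o, ho, hc⟩ := ih
    rcases hs with ⟨v, rfl⟩ | ht
    · refine ⟨o, ho, fun w => ?_⟩
      have := hc w
      by_cases hw : w = v
      · subst hw; simp; omega
      · simpa [hw] using this
    · exact compat_topple m hG _ _ o ho hc ht

theorem sourceify (m : Option V → Option V → ℕ) (hG : IsGraph m) (η : V → ℕ)
    (o : Option V → Option V → ℕ) (ho : IsOrientation m o) (hc : Compatible m o η) (y : V) :
    ∃ ξ o', IsOrientation m o' ∧ Compatible m o' ξ ∧ Reaches m ξ η ∧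
      deg m (some y) + 1 ≤ ξ y ∧ ∀ v, η v ≤ ξ v + m (some y) (some v) := by
  have hoy : o (some y) (some y) = 0 := by
    have := ho (some y) (some y); rw [hG.2.1] at this; omega
  have hle : ∀ v : V, o (some v) (some y) ≤ η v := by
    intro v
    have h1 := hc v
    have h2 : inDeg o (some v) + o (some v) (some y) ≤ deg m (some v) := by
      have : deg m (some v) = inDeg o (some v) + ∑ w, o (some v) w := by
        rw [inDeg, deg, ← Finset.sum_add_distrib]
        apply Finset.sum_congr rfl
        intro w _
        rw [← ho (some v) w, add_comm]
      rw [this]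
      exact Nat.add_le_add_left (Finset.single_le_sum (f := fun w => o (some v) w)
        (fun _ _ => Nat.zero_le _) (Finset.mem_univ (some y))) _
    omega
  have hcy := hc y
  have hom : ∀ u, o u (some y) ≤ m (some y) u := by
    intro u
    have := ho u (some y)
    have := hG.1 u (some y)
    omega
  refine ⟨fun v => if v = y then η y + inDeg o (some y) else η v - o (some v) (some y),
    fun u w => if w = some y then 0 else if u = some y then m u w else o u w, ?_, ?_, ?_, ?_, ?_⟩
  · intro u w
    have h1 := ho u w
    have h2 := hG.1 u w
    have h3 := hG.2.1 u
    dsimp only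
    by_cases hu : u = some y
    · by_cases hw : w = some y
      · subst hu; subst hw; simp [h3]
      · simp [hu, hw]
    · by_cases hw : w = some y
      · subst hw; simp [hu, h2]
      · simp [hu, hw, h1]
  · intro v
    by_cases hv : v = y
    · subst hv
      simp; omega
    · have hc' := hc v
      simp only [inDeg, hv, if_false, Option.some.injEq] at hc' ⊢
      rw [← Finset.add_sum_erase _ _ (Finset.mem_univ (some y))] at hc' ⊢
      have : ∑ u ∈ Finset.univ.erase (some y), (if u = some y then
          m u (some v) else o u (some v))
          = ∑ u ∈ Finset.univ.erase (some y), o u (some v) := by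
        apply Finset.sum_congr rfl
        intro u hu
        rw [if_neg (Finset.ne_of_mem_erase hu)]
      rw [this]
      simp only [if_true]
      have h1 := ho (some y) (some v)
      have h2 := hle v
      omega
  · refine Relation.ReflTransGen.single (Or.inr ⟨y, ?_, fun u => o u (some y), hom, ?_⟩)
    · simp; omega
    · intro v
      by_cases hv : v = y
      · subst hv
        simp [inDeg]
      · have := hle v
        simp [hv]; omega
  · simp; omega
  · intro v
    have := hom (some v)
    by_cases hv : v = y
    · subst hv; simp; omega
    · simp [hv]; omega

theorem grow_huge (m : Option V → Option V → ℕ) (hG : IsGraph m) (K : ℕ)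
    (hK : ∀ v : V, deg m (some v) ≤ K) :
    ∀ N (η : V → ℕ) o, IsOrientation m o → Compatible m o η →
      ∃ ξ o', IsOrientation m o' ∧ Compatible m o' ξ ∧ Reaches m ξ η ∧
        ∀ v ∈ (Finset.univ : Finset V), N ≤ ξ v := by
  refine grow_induction m hG (fun S => ∀ N (η : V → ℕ) o, IsOrientation m o → Compatible m o η →
      ∃ ξ o', IsOrientation m o' ∧ Compatible m o' ξ ∧ Reaches m ξ η ∧
        ∀ v ∈ S, N ≤ ξ v) ?_ ?_
  · intro N η o ho hc
    exact ⟨η, o, ho, hc, Relation.ReflTransGen.refl, by simp⟩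
  · intro S y x hS hy hx hm N η o ho hc
    have hxy : x ≠ some y := fun h => hy (hx y h)
    obtain ⟨ξ₁, o₁, ho₁, hc₁, hr₁, hN₁⟩ := hS (2 * N + 2 * K + 1) η o ho hc
    obtain ⟨ξ₂, o₂, ho₂, hc₂, hr₂, hy₂, hl₂⟩ := sourceify m hG ξ₁ o₁ ho₁ hc₁ y
    have hmK : ∀ v : V, m (some y) (some v) ≤ K := fun v =>
      (Finset.single_le_sum (f := fun w => m (some y) w)
        (fun _ _ => Nat.zero_le _) (Finset.mem_univ (some v))).trans (hK y)
    have hbig : ∀ v ∈ S, 2 * N + K + 1 ≤ ξ₂ v := by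
      intro v hv
      have := hN₁ v hv
      have := hl₂ v
      have := hmK v
      omega
    refine ⟨fun v => if v = y then ξ₂ y + N else ξ₂ v - if some v = x then N else 0, o₂, ho₂,
      ?_, ?_, ?_⟩
    · intro v
      have h1 := hc₂ v
      have h2 := hK v
      by_cases hv : v = y
      · subst hv; simp; omega
      · by_cases hvx : some v = x
        · have := hbig v (hx v hvx.symm)
          simp only [hv, if_false, if_pos hvx]; omega
        · simp [hv, hvx]; omega
    · refine Relation.ReflTransGen.trans ?_ (hr₂.trans hr₁)
      refine push_many m y x hxy (by rw [hG.1]; exact hm) N _ _ ?_ ?_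
      · simp; omega
      · intro v
        by_cases hv : v = y
        · subst hv; simp
        · by_cases hvx : some v = x
          · have := hbig v (hx v hvx.symm)
            simp [hv, hvx]; omega
          · simp [hv, hvx]
    · intro v hv
      by_cases hvy : v = y
      · subst hvy; simp
      · have := hbig v (Finset.mem_of_mem_insert_of_ne hv hvy)
        simp only [hvy, if_false]
        split_ifs <;> omega

/-- A stable configuration `η` can be reached from `η^max` by a finite
sequence of grain additions and legal partial topplings iff there is an orientation
of `G` compatible with `η`. -/
theorem sto_iff_compatible (m : Option V → Option V → ℕ) (hG : IsGraph m)
    (η : V → ℕ) (hstab : Stable m η) :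
    Reaches m (etaMax m) η ↔
      ∃ o : Option V → Option V → ℕ, IsOrientation m o ∧ Compatible m o η := by
  constructor
  · intro h
    exact compat_of_reaches m hG h
  · rintro ⟨o, ho, hc⟩
    have hK : ∃ K, ∀ v : V, deg m (some v) ≤ K :=
      ⟨∑ v : V, deg m (some v), fun v =>
        Finset.single_le_sum (f := fun v : V => deg m (some v)) (fun _ _ => Nat.zero_le _)
          (Finset.mem_univ v)⟩
    obtain ⟨K, hK⟩ := hK
    obtain ⟨η', o', ho', hc', hr, hN⟩ := grow_huge m hG K hK K η o ho hc
    exact (reaches_of_le m _ _ (fun v => (hK v).trans (hN v (Finset.mem_univ v)))).trans hr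

end SSM
end

section
/- Compatibility with an orientation is preserved by legal partial topplings after reversing the toppled edges: let η be a configuration (not necessarily stable) and O an orientation with o(u,v)+o(v,u)=m(u,v) such that in_O(v) ≥ 1 + deg(v) − η(v) (as integers) for all v ∈ V. Suppose η(a) > deg(a) for some a ∈ V and η' is obtained from η by a legal partial toppling at a with amounts α(u) (0 ≤ α(u) ≤ m(a,u)): η'(a) = η(a) − ∑_u α(u), η'(u) = η(u) + α(u) for u ∈ V, u ≠ a. Define the orientation O' by o'(u,a) = max(o(u,a), α(u)) and o'(a,u) = m(a,u) − o'(u,a) for all u, and o' = o on pairs not involving a. Then in_{O'}(v) ≥ 1 + deg(v) − η'(v) for all v ∈ V. -/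
open Finset Polynomial

open scoped Classical

namespace SSM

variable {V : Type*} [Fintype V] [DecidableEq V]

/-- Compatibility with an orientation is preserved by a legal partial
toppling after reversing the toppled edges. -/
theorem compatible_preserved_by_toppling (m : Option V → Option V → ℕ)
    (hG : IsGraph m) (η : V → ℕ)
    (o : Option V → Option V → ℕ) (ho : IsOrientation m o)
    (hcomp : ∀ v : V, deg m (some v) + 1 ≤ inDeg o (some v) + η v)
    (a : V) (ha : deg m (some a) < η a)
    (α : Option V → ℕ) (hα : ∀ u : Option V, α u ≤ m (some a) u)
    (η' : V → ℕ)
    (hη' : ∀ v : V,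
      η' v = if v = a then η a - ∑ u : Option V, α u else η v + α (some v))
    (o' : Option V → Option V → ℕ)
    (ho' : ∀ u w : Option V,
      o' u w = if w = some a then max (o u (some a)) (α u)
        else if u = some a then m (some a) w - max (o w (some a)) (α w)
        else o u w) :
    ∀ v : V, deg m (some v) + 1 ≤ inDeg o' (some v) + η' v := by
  intro v
  by_cases hv : v = a
  · subst hv
    have h1 : ∑ u : Option V, α u ≤ deg m (some v) := Finset.sum_le_sum fun u _ => hα u
    have h2 : ∑ u : Option V, α u ≤ inDeg o' (some v) := by
      refine Finset.sum_le_sum fun u _ => ?_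
      rw [ho', if_pos rfl]
      exact le_max_right _ _
    have h3 := hη' v
    rw [if_pos rfl] at h3
    omega
  · have h3 := hη' v
    rw [if_neg hv] at h3
    have hv' : some v ≠ some a := fun h => hv (Option.some.inj h)
    have h1 : inDeg o (some v) ≤
        ∑ u : Option V, (o' u (some v) + if u = some a then α (some v) else 0) := by
      refine Finset.sum_le_sum fun u _ => ?_
      rw [ho', if_neg hv']
      by_cases hu : u = some a
      · subst hu
        have e1 := ho (some a) (some v)
        have e2 := hα (some v)
        simp only [if_true]
        omega
      · simp [hu]
    rw [Finset.sum_add_distrib, Finset.sum_ite_eq' Finset.univ (some a),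
      if_pos (Finset.mem_univ _)] at h1
    have h4 := hcomp v
    change inDeg o (some v) ≤ inDeg o' (some v) + _ at h1
    omega


end SSM
end

section
/- A stable configuration η on G is compatible with some acyclic orientation of G if and only if η passes the burning algorithm (i.e., is deterministically recurrent for the Abelian sandpile model). -/
open Finset Polynomial

open scoped Classical

namespace SSM

variable {V : Type*} [Fintype V] [DecidableEq V]

lemma deg_eq_in_add_out (m o : Option V → Option V → ℕ) (ho : IsOrientation m o)
    (v : Option V) : deg m v = inDeg o v + ∑ w : Option V, o v w := by
  unfold deg inDeg
  rw [← Finset.sum_add_distrib]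
  refine Finset.sum_congr rfl fun w _ => ?_
  have := ho v w
  omega

lemma exists_topo (r : V → V → Prop) (hr : ∀ u, ¬ Relation.TransGen r u u) :
    ∃ e : Fin (Fintype.card V) ≃ V, ∀ i j, r (e i) (e j) → i < j := by
  let P : PartialOrder V :=
    { le := Relation.ReflTransGen r
      le_refl := fun _ => Relation.ReflTransGen.refl
      le_trans := fun _ _ _ => Relation.ReflTransGen.trans
      le_antisymm := by
        intro a b hab hba
        rcases Relation.reflTransGen_iff_eq_or_transGen.1 hab with h | h
        · exact h.symm
        · exact absurd (h.trans_left hba) (hr a) }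
  let f : V → LinearExtension V := @toLinearExtension V P
  letI : Fintype (LinearExtension V) := (inferInstance : Fintype V)
  let g : Fin (Fintype.card V) ≃o LinearExtension V :=
    Fintype.orderIsoFinOfCardEq (LinearExtension V) rfl
  refine ⟨g.toEquiv, fun i j hij => ?_⟩
  have h1 : g i ≤ g j :=
    (@toLinearExtension V P).monotone (Relation.ReflTransGen.single hij)
  have h2 : i ≤ j := g.le_iff_le.1 h1
  refine lt_of_le_of_ne h2 ?_
  rintro rfl
  exact hr _ (Relation.TransGen.single hij)

/-- A stable configuration is compatible with some acyclic orientation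
of `G` iff it passes the burning algorithm (is deterministically recurrent). -/
theorem acyclic_compatible_iff_burns (m : Option V → Option V → ℕ) (hG : IsGraph m)
    (η : V → ℕ) (hstab : Stable m η) :
    (∃ o : Option V → Option V → ℕ,
      IsOrientation m o ∧ IsAcyclic o ∧ Compatible m o η) ↔ Burns m η := by
  obtain ⟨hsym, hloop, -⟩ := hG
  constructor
  · rintro ⟨o, ho, hac, hc⟩
    obtain ⟨e, he⟩ := exists_topo (fun a b : V => 1 ≤ o (some a) (some b)) (by
      intro u hu
      exact hac (some u) (Relation.TransGen.lift (r := fun a b : V => 1 ≤ o (some a) (some b)) (p := fun a b => 1 ≤ o a b) some (fun _ _ h => h) u u hu))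
    refine ⟨e, fun i => ?_⟩
    have h1 := deg_eq_in_add_out m o ho (some (e i))
    have h2 := hc (e i)
    have h3 : ∑ j ∈ Finset.univ.filter (fun j : Fin (Fintype.card V) => i < j),
        m (some (e i)) (some (e j)) ≤ ∑ w : Option V, o (some (e i)) w := by
      rw [Fintype.sum_option, ← Equiv.sum_comp e]
      refine le_trans ?_ (Nat.le_add_left _ _)
      refine le_trans (Finset.sum_le_sum fun j hj => ?_)
        (Finset.sum_le_sum_of_subset (Finset.filter_subset _ _))
      have hij : i < j := (Finset.mem_filter.1 hj).2
      have h4 : ¬ 1 ≤ o (some (e j)) (some (e i)) := fun h => lt_asymm hij (he _ _ h)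
      have := ho (some (e i)) (some (e j))
      omega
    omega
  · rintro ⟨e, he⟩
    let rk : Option V → ℕ := fun u => u.elim 0 (fun v => (e.symm v : ℕ) + 1)
    have hrk : ∀ u w, rk u = rk w → u = w := by
      rintro (_ | u) (_ | w) h
      · rfl
      · simp [rk] at h
      · simp [rk] at h
      · have h' : (e.symm u : ℕ) = e.symm w := by simpa [rk] using h
        rw [e.symm.injective (Fin.ext h')]
    let o : Option V → Option V → ℕ := fun u w => if rk u < rk w then m u w else 0
    have ho : IsOrientation m o := by
      intro u w
      simp only [o]
      rcases lt_trichotomy (rk u) (rk w) with h | h | h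
      · simp [h, h.le]
      · have := hrk _ _ h
        subst this
        simp [hloop]
      · simp [h, h.le, hsym u w]
    refine ⟨o, ho, ?_, ?_⟩
    · intro u hu
      have key : ∀ a b, Relation.TransGen (fun x y : Option V => 1 ≤ o x y) a b →
          rk a < rk b := by
        intro a b hab
        have step : ∀ x y, 1 ≤ o x y → rk x < rk y := by
          intro x y h
          by_contra hn
          simp [o, hn] at h
        induction hab with
        | single h => exact step _ _ h
        | tail _ h ih => exact ih.trans (step _ _ h)
      exact lt_irrefl _ (key u u hu)
    · intro v
      obtain ⟨i, rfl⟩ := e.surjective v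
      have h1 := deg_eq_in_add_out m o ho (some (e i))
      have h2 := he i
      have h3 : ∑ w : Option V, o (some (e i)) w =
          ∑ j ∈ Finset.univ.filter (fun j : Fin (Fintype.card V) => i < j),
            m (some (e i)) (some (e j)) := by
        rw [Fintype.sum_option, ← Equiv.sum_comp e, Finset.sum_filter]
        simp [o, rk]
      omega

end SSM
end

section
/- Every stable configuration on G that passes the burning algorithm is compatible with some orientation of G; that is, the set of deterministically recurrent configurations is contained in the set Sto(G) of stable configurations compatible with at least one orientation. -/
open Finset Polynomial

open scoped Classical

namespace SSM

variable {V : Type*} [Fintype V] [DecidableEq V]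

/-- Every stable configuration passing the burning algorithm is
compatible with some orientation of `G`, i.e. lies in `Sto(G)`. -/
theorem det_subset_sto (m : Option V → Option V → ℕ) (hG : IsGraph m)
    (η : V → ℕ) (hstab : Stable m η) (hburn : Burns m η) :
    Sto m η := by
  obtain ⟨hs, hl, -⟩ := hG
  obtain ⟨e, he⟩ := hburn
  let r : Option V → ℕ := fun u => u.elim 0 (fun v => (e.symm v : ℕ) + 1)
  have hr : ∀ u w, r u = r w → u = w := by
    intro u w h
    cases u <;> cases w <;> simp [r] at h ⊢
    exact e.symm.injective (Fin.ext h)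
  refine ⟨hstab, fun u w => if r u < r w then m u w else 0, ?_, ?_⟩
  · intro u w
    rcases lt_trichotomy (r u) (r w) with h | h | h
    · simp [h, h.le.not_gt]
    · have := hr u w h
      subst this
      simp [hl]
    · simp [h, h.le.not_gt, hs u w]
  · intro v
    have h1 : deg m (some v) = inDeg (fun u w => if r u < r w then m u w else 0) (some v)
        + ∑ u : Option V, (if r (some v) < r u then m (some v) u else 0) := by
      unfold deg inDeg
      rw [← Finset.sum_add_distrib]
      refine Finset.sum_congr rfl fun u _ => ?_
      rcases lt_trichotomy (r u) (r (some v)) with h | h | h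
      · simp [h, h.le.not_gt, hs u (some v)]
      · have := hr _ _ h
        subst this
        simp [hl]
      · simp [h, h.le.not_gt]
    have h2 : ∑ u : Option V, (if r (some v) < r u then m (some v) u else 0) < η v := by
      have h3 := he (e.symm v)
      rw [Finset.sum_filter] at h3
      simp only [Equiv.apply_symm_apply] at h3
      rw [Fintype.sum_option, ← e.sum_comp]
      simpa [r] using h3
    omega

end SSM
end

section
/- If G is a tree (i.e., the total number of edges |E| = (1/2)∑_{u,v} m(u,v) equals the number of vertices |V ∪ {s}| − 1 = |V|), then the only configuration in Sto(G) is the maximal stable configuration η^max, and hence L_G(x) = 1. -/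
open Finset Polynomial

open scoped Classical

namespace SSM

variable {V : Type*} [Fintype V] [DecidableEq V]

/-- If `G` is a tree (`|E| = |V|`, counting non-sink vertices), then
the only configuration in `Sto(G)` is `η^max`, and `L_G(x) = 1`. -/
theorem tree_sto_and_lackingPoly (m : Option V → Option V → ℕ) (hG : IsGraph m)
    (htree : ∑ u : Option V, ∑ w : Option V, m u w = 2 * Fintype.card V) :
    (∀ η : V → ℕ, Sto m η ↔ η = etaMax m) ∧ lackingPoly m = 1 := by
  have hsum : ∀ o, IsOrientation m o → ∑ v : V, inDeg o (some v) ≤ Fintype.card V := by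
    intro o ho
    have h1 : ∑ u : Option V, ∑ w : Option V, (o u w + o w u) = 2 * Fintype.card V := by
      rw [← htree]
      exact Finset.sum_congr rfl fun u _ => Finset.sum_congr rfl fun w _ => ho u w
    simp only [Finset.sum_add_distrib] at h1
    rw [Finset.sum_comm] at h1
    have h2 : ∑ w : Option V, inDeg o w = inDeg o none + ∑ v : V, inDeg o (some v) :=
      Fintype.sum_option _
    unfold inDeg at h2 ⊢
    omega
  have key : ∀ η : V → ℕ, Sto m η ↔ η = etaMax m := by
    intro η
    constructor
    · rintro ⟨hs, o, ho, hc⟩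
      have h1 := Finset.sum_le_sum (s := Finset.univ) fun v _ => hc v
      simp only [Finset.sum_add_distrib, Finset.sum_const, Finset.card_univ, smul_eq_mul,
        mul_one] at h1
      have h2 := hsum o ho
      have h3 : ∑ v : V, η v = ∑ v : V, deg m (some v) :=
        le_antisymm (Finset.sum_le_sum fun v _ => hs v) (by omega)
      have h4 := (Finset.sum_eq_sum_iff_of_le (fun v _ => hs v)).1 h3
      funext v
      exact h4 v (Finset.mem_univ v)
    · rintro rfl
      refine ⟨fun v => le_refl _, ?_⟩
      obtain ⟨hsym, hloop, hconn⟩ := hG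
      set G := SimpleGraph.fromRel fun u w : Option V => m u w ≠ 0 with hGdef
      let d : Option V → ℕ := fun u => G.dist u none
      let e := Fintype.equivFin (Option V)
      let o : Option V → Option V → ℕ := fun u w =>
        if d u < d w ∨ (d u = d w ∧ e u < e w) then m u w else 0
      refine ⟨o, ?_, ?_⟩
      · intro u w
        by_cases huw : u = w
        · subst huw
          simp [o, hloop]
        · have hne : e u ≠ e w := fun h => huw (e.injective h)
          have hne2 : (e u : ℕ) ≠ (e w : ℕ) := fun h => hne (Fin.ext h)
          have hs := hsym u w
          simp only [o, Fin.lt_def]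
          split_ifs <;> omega
      · intro v
        obtain ⟨p, hp⟩ := hconn.exists_walk_length_eq_dist (some v) none
        have : ∃ u, m u (some v) ≠ 0 ∧ d u < d (some v) := by
          cases p with
          | @cons _ u _ h q =>
            refine ⟨u, ?_, ?_⟩
            · rw [hGdef, SimpleGraph.fromRel_adj] at h
              rcases h.2 with h | h
              · rwa [hsym]
              · exact h
            · have := SimpleGraph.dist_le q
              rw [SimpleGraph.Walk.length_cons] at hp
              simp only [d]
              omega
        obtain ⟨u, hu, hd⟩ := this
        have h1 : o u (some v) ≤ inDeg o (some v) :=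
          Finset.single_le_sum (f := fun u => o u (some v)) (fun _ _ => Nat.zero_le _)
            (Finset.mem_univ u)
        have h2 : o u (some v) = m u (some v) := by simp [o, hd]
        simp only [etaMax]
        omega
  refine ⟨key, ?_⟩
  have hf : (Fintype.piFinset fun v : V => Finset.range (deg m (some v) + 1)).filter
      (fun η => Sto m η) = {etaMax m} := by
    ext η
    simp only [Finset.mem_filter, Finset.mem_singleton, key, Fintype.mem_piFinset,
      Finset.mem_range]
    constructor
    · exact fun h => h.2
    · rintro rfl
      exact ⟨fun v => Nat.lt_succ_self _, rfl⟩
  unfold lackingPoly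
  rw [hf]
  simp [totalLacking, etaMax]

end SSM
end

section
/- Suppose V is partitioned as V = V_1 ⊔ … ⊔ V_q with m(u,v) = 0 whenever u ∈ V_i and v ∈ V_j with i ≠ j, and suppose each induced sub-multigraph G_i on V_i ∪ {s} is connected (so G is the product of the G_i, glued only at the sink). Then a stable configuration η on G belongs to Sto(G) if and only if each restriction η|_{V_i} belongs to Sto(G_i); consequently L_G(x) = ∏_{i=1}^q L_{G_i}(x). -/
open Finset Polynomial

open scoped Classical

namespace SSM

variable {V : Type*} [Fintype V] [DecidableEq V]

section Helpers

theorem sum_option_sigma {ι : Type*} [Fintype ι]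
    {V : ι → Type*} [∀ i, Fintype (V i)] (i : ι) (f : Option ((i : ι) × V i) → ℕ)
    (hf : ∀ (j : ι) (v : V j), i ≠ j → f (some ⟨j, v⟩) = 0) :
    ∑ u, f u = ∑ u : Option (V i), f (Option.map (Sigma.mk i) u) := by
  rw [Fintype.sum_option, Fintype.sum_option, Fintype.sum_sigma]
  congr 1
  rw [Finset.sum_eq_single i]
  · rfl
  · intro j _ hj
    exact Finset.sum_eq_zero fun v _ => hf j v hj.symm
  · intro h
    exact absurd (Finset.mem_univ i) h

/-- Gluing of orientations. -/
noncomputable def glueO {ι : Type*} {V : ι → Type*}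
    (o : ∀ i, Option (V i) → Option (V i) → ℕ) :
    Option ((i : ι) × V i) → Option ((i : ι) × V i) → ℕ
  | none, none => 0
  | none, some w => o w.1 none (some w.2)
  | some u, none => o u.1 (some u.2) none
  | some u, some w => if h : w.1 = u.1 then o u.1 (some u.2) (some (h ▸ w.2)) else 0

theorem glueO_map {ι : Type*} {V : ι → Type*}
    (o : ∀ i, Option (V i) → Option (V i) → ℕ) (i : ι) (u : Option (V i)) (v : V i) :
    glueO o (Option.map (Sigma.mk i) u) (some ⟨i, v⟩) = o i u (some v) := by
  cases u <;> simp [glueO]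

end Helpers

/-- If `V` is partitioned into parts `V i` with no edges between
distinct parts and each induced sub-multigraph `G i` (on `V i ∪ {s}`) connected,
then `η ∈ Sto(G)` iff each restriction `η|_{V i} ∈ Sto(G i)`; consequently
`L_G(x) = ∏ i, L_{G i}(x)`. -/
theorem product_sto_and_lackingPoly {ι : Type*} [Fintype ι] [DecidableEq ι]
    {V : ι → Type*} [∀ i, Fintype (V i)] [∀ i, DecidableEq (V i)]
    (m : Option ((i : ι) × V i) → Option ((i : ι) × V i) → ℕ)
    (hG : IsGraph m)
    (hcross : ∀ (i j : ι) (u : V i) (v : V j), i ≠ j →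
      m (some ⟨i, u⟩) (some ⟨j, v⟩) = 0)
    (hconn : ∀ i : ι, (SimpleGraph.fromRel fun u w : Option (V i) =>
      m (Option.map (Sigma.mk i) u) (Option.map (Sigma.mk i) w) ≠ 0).Connected) :
    (∀ η : ((i : ι) × V i) → ℕ,
      Sto m η ↔ ∀ i : ι,
        Sto (fun u w : Option (V i) =>
            m (Option.map (Sigma.mk i) u) (Option.map (Sigma.mk i) w))
          (fun v : V i => η ⟨i, v⟩)) ∧
    lackingPoly m = ∏ i : ι,
      lackingPoly (fun u w : Option (V i) =>
        m (Option.map (Sigma.mk i) u) (Option.map (Sigma.mk i) w)) := by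
  obtain ⟨hsymm, hloop, -⟩ := hG
  have hdeg : ∀ (i : ι) (v : V i), deg m (some ⟨i, v⟩) =
      deg (fun u w : Option (V i) =>
        m (Option.map (Sigma.mk i) u) (Option.map (Sigma.mk i) w)) (some v) := by
    intro i v
    exact sum_option_sigma i (fun w => m (some ⟨i, v⟩) w) (fun j w h => hcross i j v w h)
  have main : ∀ η : ((i : ι) × V i) → ℕ,
      Sto m η ↔ ∀ i : ι,
        Sto (fun u w : Option (V i) =>
            m (Option.map (Sigma.mk i) u) (Option.map (Sigma.mk i) w))
          (fun v : V i => η ⟨i, v⟩) := by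
    intro η
    constructor
    · rintro ⟨hs, o, ho, hc⟩ i
      refine ⟨fun v => ?_, fun u w => o (Option.map (Sigma.mk i) u) (Option.map (Sigma.mk i) w),
        fun u w => ho _ _, fun v => ?_⟩
      · rw [← hdeg]
        exact hs _
      · rw [← hdeg]
        have h1 : inDeg o (some ⟨i, v⟩) = inDeg (fun u w : Option (V i) =>
            o (Option.map (Sigma.mk i) u) (Option.map (Sigma.mk i) w)) (some v) := by
          refine sum_option_sigma i (fun w => o w (some ⟨i, v⟩)) (fun j w h => ?_)
          have h2 := ho (some ⟨j, w⟩) (some ⟨i, v⟩)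
          rw [hcross j i w v h.symm] at h2
          show o (some ⟨j, w⟩) (some ⟨i, v⟩) = 0
          omega
        rw [← h1]
        exact hc _
    · intro h
      choose hs o ho hc using h
      refine ⟨?_, glueO o, ?_, ?_⟩
      · rintro ⟨i, v⟩
        rw [hdeg]
        exact hs i v
      · rintro (_ | ⟨i, u⟩) (_ | ⟨j, w⟩)
        · simp [glueO, hloop]
        · exact ho j none (some w)
        · exact ho i (some u) none
        · by_cases hij : i = j
          · subst hij
            have := ho i (some u) (some w)
            simpa [glueO] using this
          · rw [hcross i j u w hij]
            simp [glueO, hij, Ne.symm hij]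
      · rintro ⟨i, v⟩
        have h1 : inDeg (glueO o) (some ⟨i, v⟩) = inDeg (o i) (some v) := by
          unfold inDeg
          rw [sum_option_sigma i (fun w => glueO o w (some ⟨i, v⟩))]
          · exact Finset.sum_congr rfl fun u _ => glueO_map o i u v
          · intro j w hij
            simp [glueO, hij]
        rw [h1, hdeg]
        exact hc i v
  refine ⟨main, ?_⟩
  unfold lackingPoly
  rw [Finset.prod_univ_sum]
  refine Finset.sum_bij' (fun η _ i v => η ⟨i, v⟩) (fun p _ x => p x.1 x.2) ?_ ?_ ?_ ?_ ?_
  · intro η hη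
    simp only [Finset.mem_filter, Fintype.mem_piFinset, Finset.mem_range] at hη ⊢
    intro i
    refine ⟨fun v => ?_, (main η).1 hη.2 i⟩
    rw [← hdeg]
    exact hη.1 _
  · intro p hp
    simp only [Finset.mem_filter, Fintype.mem_piFinset, Finset.mem_range] at hp ⊢
    refine ⟨?_, (main _).2 fun i => (hp i).2⟩
    rintro ⟨i, v⟩
    rw [hdeg]
    exact (hp i).1 v
  · intro η _
    rfl
  · intro p _
    rfl
  · intro η _
    rw [Finset.prod_pow_eq_pow_sum]
    congr 1
    unfold totalLacking
    rw [Fintype.sum_sigma]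
    refine Finset.sum_congr rfl fun i _ => Finset.sum_congr rfl fun v _ => ?_
    rw [hdeg]


end SSM
end

section
/- Let T = (V' ∪ {r}, E') be a tree branch of G. Then for every η ∈ Sto(G) and every orientation O compatible with η, each vertex v ∈ V' has exactly one incoming edge in O, that edge lies in E', and l_η(v) = 0 (i.e., η(v) = deg(v)); moreover every edge of E' incident to r is oriented away from r in O. -/
open Finset Polynomial

open scoped Classical

namespace SSM

variable {V : Type*} [Fintype V] [DecidableEq V]

/-- If `T = (V' ∪ {r}, E')` is a tree branch of `G`, then for every
`η ∈ Sto(G)` and every compatible orientation `O`: each `v ∈ V'` has exactly one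
incoming edge, that edge lies in `E'`, and `l_η(v) = 0`; moreover every edge of
`E'` incident to `r` is oriented away from `r`. -/
theorem tree_branch_orientation (m : Option V → Option V → ℕ) (hG : IsGraph m)
    (V' : Finset V) (r : V) (mT : V → V → ℕ) (hT : IsTreeBranch m V' r mT)
    (η : V → ℕ) (hη : Sto m η)
    (o : Option V → Option V → ℕ) (ho : IsOrientation m o) (hc : Compatible m o η) :
    (∀ v ∈ V', inDeg o (some v) = 1 ∧ η v = deg m (some v) ∧
      ∀ u : Option V, 1 ≤ o u (some v) → ∃ u' : V, u = some u' ∧ mT u' v ≠ 0) ∧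
    (∀ v : V, mT r v ≠ 0 → mT r v ≤ o (some r) (some v)) := by
  have hst := hη.1
  -- edges at vertices of `V'` agree with edges of the branch
  have key : ∀ v ∈ V', m (some v) none = 0 ∧ ∀ u, mT v u = m (some v) (some u) := by
    intro v hv
    have h1 := hT.deg_eq v hv
    unfold deg at h1
    rw [Fintype.sum_option] at h1
    have h2 : ∑ u : V, mT v u ≤ ∑ u : V, m (some v) (some u) :=
      Finset.sum_le_sum fun u _ => hT.le v u
    refine ⟨by omega, fun u => ?_⟩
    have h3 : ∑ u : V, mT v u = ∑ u : V, m (some v) (some u) := by omega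
    exact (Finset.sum_eq_sum_iff_of_le fun u _ => hT.le v u).1 h3 u (Finset.mem_univ u)
  obtain ⟨b, hb⟩ : ∃ b : V → V → ℕ,
      b = fun u v => if mT u v ≠ 0 then o (some u) (some v) else 0 := ⟨_, rfl⟩
  have hbb : ∀ u v, b u v + b v u = mT u v := by
    intro u v
    rw [hb]
    by_cases h : mT u v = 0
    · have h' : mT v u = 0 := by rw [hT.symm]; exact h
      simp [h, h']
    · have h' : mT v u ≠ 0 := by rw [hT.symm]; exact h
      simp only [ne_eq, h, not_false_eq_true, if_true, h']
      rw [ho]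
      obtain ⟨hu, hv⟩ := hT.support u v h
      rcases hu with hu | hu
      · exact ((key u hu).2 v).symm
      · rcases hv with hv | hv
        · rw [hT.symm, hG.1]
          exact ((key v hv).2 u).symm
        · subst hu; subst hv
          exact absurd (hT.loopless _) h
  have htot : ∑ v : V, ∑ u : V, b u v = V'.card := by
    have h1 := hT.card_edges
    simp only [← hbb, Finset.sum_add_distrib] at h1
    have h2 : ∑ u : V, ∑ v : V, b u v = ∑ v : V, ∑ u : V, b u v := Finset.sum_comm
    omega
  have hin0 : ∀ v ∈ V', ∀ u : Option V, 1 ≤ o u (some v) →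
      ∃ u' : V, u = some u' ∧ mT u' v ≠ 0 := by
    intro v hv u hu
    have h1 := ho u (some v)
    rw [hG.1] at h1
    cases u with
    | none => have := (key v hv).1; omega
    | some u =>
      refine ⟨u, rfl, ?_⟩
      rw [hT.symm, (key v hv).2]
      omega
  have hin : ∀ v ∈ V', inDeg o (some v) = ∑ u : V, b u v := by
    intro v hv
    unfold inDeg
    rw [Fintype.sum_option]
    have h0 : o none (some v) = 0 := by
      by_contra h
      obtain ⟨u', h1, _⟩ := hin0 v hv none (by omega)
      cases h1
    rw [h0, zero_add]
    refine Finset.sum_congr rfl fun u _ => ?_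
    rw [hb]
    by_cases h : mT u v = 0
    · simp only [h, ne_eq, not_true_eq_false, if_false]
      by_contra h2
      obtain ⟨u', h1, h3⟩ := hin0 v hv (some u) (by omega)
      cases h1
      exact h3 h
    · simp [h]
  have hge : ∀ v ∈ V', 1 ≤ ∑ u : V, b u v := by
    intro v hv
    rw [← hin v hv]
    have h1 := hc v
    have h2 := hst v
    omega
  have hle : ∑ v ∈ insert r V', ∑ u : V, b u v ≤ V'.card := by
    rw [← htot]
    exact Finset.sum_le_sum_of_subset (Finset.subset_univ _)
  rw [Finset.sum_insert hT.not_mem] at hle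
  have hcard : ∑ v ∈ V', 1 = V'.card := by simp
  have hsum : ∑ v ∈ V', 1 ≤ ∑ v ∈ V', ∑ u : V, b u v := Finset.sum_le_sum hge
  have hr : ∑ u : V, b u r = 0 := by omega
  have heq : ∀ v ∈ V', 1 = ∑ u : V, b u v :=
    (Finset.sum_eq_sum_iff_of_le hge).1 (by omega)
  refine ⟨fun v hv => ?_, fun v hv => ?_⟩
  · have h1 : inDeg o (some v) = 1 := by rw [hin v hv, ← heq v hv]
    refine ⟨h1, ?_, hin0 v hv⟩
    have h2 := hc v
    have h3 := hst v
    omega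
  · have h1 : b v r = 0 := (Finset.sum_eq_zero_iff.1 hr) v (Finset.mem_univ v)
    have h2 := hbb r v
    have h3 : b r v = o (some r) (some v) := by rw [hb]; simp [hv]
    omega

end SSM
end

section
/- The degree of the lacking polynomial L_G equals the cycle number c(G) = |E| − |V| of G, where |E| = (1/2)∑_{u,v} m(u,v) is the total number of edges and |V| is the number of non-sink vertices; equivalently, the maximum of the total lacking number ℓ(η) over all η ∈ Sto(G) equals |E| − |V|. -/
open Finset Polynomial

open scoped Classical

namespace SSM

variable {V : Type*} [Fintype V] [DecidableEq V]

lemma sum_inDeg (m o : Option V → Option V → ℕ) (ho : IsOrientation m o) :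
    2 * ∑ w : Option V, inDeg o w = ∑ u : Option V, ∑ w : Option V, m u w := by
  have h1 : ∑ u : Option V, ∑ w : Option V, m u w
      = ∑ u : Option V, ∑ w : Option V, o u w + ∑ u : Option V, ∑ w : Option V, o w u := by
    rw [← Finset.sum_add_distrib]
    refine Finset.sum_congr rfl fun u _ => ?_
    rw [← Finset.sum_add_distrib]
    exact Finset.sum_congr rfl fun w _ => (ho u w).symm
  rw [h1, Finset.sum_comm (f := fun u w => o u w)]
  simp only [inDeg]
  ring

lemma lacking_upper (m : Option V → Option V → ℕ) (η : V → ℕ) (h : Sto m η) :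
    2 * (totalLacking m η + Fintype.card V) ≤ ∑ u : Option V, ∑ w : Option V, m u w := by
  obtain ⟨hs, o, ho, hc⟩ := h
  rw [← sum_inDeg m o ho, Fintype.sum_option]
  have : totalLacking m η + Fintype.card V ≤ ∑ v : V, inDeg o (some v) := by
    rw [totalLacking, Fintype.card_eq_sum_ones, ← Finset.sum_add_distrib]
    refine Finset.sum_le_sum fun v _ => ?_
    have := hs v
    have := hc v
    omega
  omega

lemma exists_good_orientation (m : Option V → Option V → ℕ) (hG : IsGraph m) :
    ∃ o, IsOrientation m o ∧ inDeg o none = 0 ∧ ∀ v : V, 1 ≤ inDeg o (some v) := by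
  obtain ⟨hsym, hloop, hconn⟩ := hG
  set G := SimpleGraph.fromRel fun u w : Option V => m u w ≠ 0 with hGdef
  let r := Fintype.equivFin (Option V)
  let key : Option V → ℕ ×ₗ Fin (Fintype.card (Option V)) := fun u => toLex (G.dist u none, r u)
  have hinj : ∀ u w, key u = key w → u = w := by
    intro u w h
    have h2 : (G.dist u none, r u) = (G.dist w none, r w) := toLex.injective h
    exact r.injective (Prod.ext_iff.1 h2).2
  refine ⟨fun u w => if key u < key w then m u w else 0, ?_, ?_, ?_⟩
  · intro u w
    rcases lt_trichotomy (key u) (key w) with h | h | h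
    · simp [h, h.not_gt]
    · obtain rfl := hinj _ _ h
      simp [hloop]
    · simp [h, h.not_gt, hsym w u]
  · refine Finset.sum_eq_zero fun u _ => ?_
    dsimp only
    rw [if_neg]
    intro h
    rcases Prod.Lex.toLex_lt_toLex.1 h with h | ⟨h, h'⟩
    · simp at h
    · simp only [SimpleGraph.dist_self] at h
      have := (hconn.dist_eq_zero_iff).1 h
      subst this
      exact lt_irrefl _ h'
  · intro v
    obtain ⟨p, hp⟩ := hconn.exists_walk_length_eq_dist (some v) none
    cases p with
    | @cons _ u _ hadj q =>
      have hle : G.dist u none ≤ q.length := SimpleGraph.dist_le q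
      simp only [SimpleGraph.Walk.length_cons] at hp
      have hk : key u < key (some v) := Prod.Lex.toLex_lt_toLex.2 (Or.inl (by omega))
      have hm : m u (some v) ≠ 0 := by
        rw [hGdef, SimpleGraph.fromRel_adj] at hadj
        rcases hadj.2 with h | h
        · rwa [hsym]
        · exact h
      have := Finset.single_le_sum (f := fun u => if key u < key (some v) then m u (some v) else 0)
        (fun _ _ => Nat.zero_le _) (Finset.mem_univ u)
      simp only [hk, if_true] at this
      exact le_trans (Nat.one_le_iff_ne_zero.2 hm) this

lemma lacking_attained (m : Option V → Option V → ℕ) (hG : IsGraph m) :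
    ∃ η, Sto m η ∧
      2 * (totalLacking m η + Fintype.card V) = ∑ u : Option V, ∑ w : Option V, m u w := by
  obtain ⟨o, ho, h0, h1⟩ := exists_good_orientation m hG
  have hle : ∀ v : V, inDeg o (some v) ≤ deg m (some v) := fun v =>
    Finset.sum_le_sum fun u _ => by have := ho (some v) u; omega
  refine ⟨fun v => deg m (some v) + 1 - inDeg o (some v), ⟨?_, o, ho, ?_⟩, ?_⟩
  · intro v
    have := h1 v
    dsimp only
    omega
  · intro v
    have := hle v
    dsimp only
    omega
  · rw [← sum_inDeg m o ho, Fintype.sum_option, h0, zero_add, totalLacking,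
      Fintype.card_eq_sum_ones, ← Finset.sum_add_distrib]
    congr 1
    refine Finset.sum_congr rfl fun v _ => ?_
    have := h1 v
    have := hle v
    omega

/-- The degree of the lacking polynomial equals the cycle number
`c(G) = |E| − |V|`; stated additively: `2·(deg L_G + |V|) = ∑_{u,w} m u w = 2·|E|`. -/
theorem lackingPoly_natDegree (m : Option V → Option V → ℕ) (hG : IsGraph m) :
    2 * ((lackingPoly m).natDegree + Fintype.card V) =
      ∑ u : Option V, ∑ w : Option V, m u w := by
  obtain ⟨η, hη, hE⟩ := lacking_attained m hG
  rw [← hE]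
  congr 2
  apply le_antisymm
  · refine Polynomial.natDegree_sum_le_of_forall_le _ _ fun ξ hξ => ?_
    have := lacking_upper m ξ (Finset.mem_filter.1 hξ).2
    rw [Polynomial.natDegree_X_pow]
    omega
  · apply Polynomial.le_natDegree_of_ne_zero
    rw [lackingPoly, Polynomial.finsetSum_coeff]
    apply ne_of_gt
    refine Finset.sum_pos' (fun ξ _ => ?_) ⟨η, ?_, ?_⟩
    · rw [Polynomial.coeff_X_pow]
      split_ifs <;> simp
    · refine Finset.mem_filter.2 ⟨Fintype.mem_piFinset.2 fun v => ?_, hη⟩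
      exact Finset.mem_range.2 (Nat.lt_succ_of_le (hη.1 v))
    · simp [Polynomial.coeff_X_pow]

end SSM
end
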